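/- Let P be a simple polygon and let D be an internal diagonal of P joining vertices u and v. Then D splits P into two simple polygons P₁ and P₂, each having D as an edge, whose interiors are disjoint and whose union together with D equals the closed region bounded by P; moreover, every vertex of P other than u and v is a vertex of exactly one of P₁, P₂. -/

import Mathlib

open Set

/-- Points in the plane. -/
abbrev Pt := ℝ × ℝ

/-- Orientation (twice signed area) of a triple of points. -/
noncomputable def orient (a b c : Pt) : ℝ :=
  (b.1 - a.1) * (c.2 - a.2) - (b.2 - a.2) * (c.1 - a.1)

/-- A simple polygon: a cyclic sequence of at least three distinct vertices whose
consecutive-vertex edges meet only as forced (adjacent edges share exactly their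
common vertex, non-adjacent edges are disjoint). -/
structure SimplePolygon where
  n : ℕ
  three_le : 3 ≤ n
  verts : ZMod n → Pt
  inj : Function.Injective verts
  edges_nonadj : ∀ i j : ZMod n, j ≠ i → j ≠ i + 1 → i ≠ j + 1 →
    segment ℝ (verts i) (verts (i + 1)) ∩ segment ℝ (verts j) (verts (j + 1)) = ∅
  edges_adj : ∀ i : ZMod n,
    segment ℝ (verts i) (verts (i + 1)) ∩ segment ℝ (verts (i + 1)) (verts (i + 1 + 1))
      = {verts (i + 1)}

/-- The boundary curve of a simple polygon. -/
def SimplePolygon.boundary (P : SimplePolygon) : Set Pt :=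
  ⋃ i : ZMod P.n, segment ℝ (P.verts i) (P.verts (i + 1))

/-- The interior region of a simple polygon: points off the boundary whose connected
component in the complement of the boundary is bounded. -/
def SimplePolygon.interiorRegion (P : SimplePolygon) : Set Pt :=
  {x | x ∉ P.boundary ∧ Bornology.IsBounded (connectedComponentIn P.boundaryᶜ x)}

/-- The exterior region of a simple polygon: points off the boundary whose connected
component in the complement of the boundary is unbounded. -/
def SimplePolygon.exteriorRegion (P : SimplePolygon) : Set Pt :=
  {x | x ∉ P.boundary ∧ ¬ Bornology.IsBounded (connectedComponentIn P.boundaryᶜ x)}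

/-- `v` is a vertex of the polygon `P`. -/
def SimplePolygon.IsVertex (P : SimplePolygon) (v : Pt) : Prop := v ∈ Set.range P.verts

/-- The (unordered) pair `u v` forms an edge of `P`. -/
def SimplePolygon.IsEdgeOf (P : SimplePolygon) (u v : Pt) : Prop :=
  ∃ i : ZMod P.n, (u = P.verts i ∧ v = P.verts (i + 1)) ∨ (v = P.verts i ∧ u = P.verts (i + 1))

/-- The segment `uv` is an internal diagonal of `P`: a segment joining two
non-adjacent vertices whose relative interior lies in the interior of `P`. -/
def SimplePolygon.IsInternalDiagonal (P : SimplePolygon) (u v : Pt) : Prop :=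
  P.IsVertex u ∧ P.IsVertex v ∧ u ≠ v ∧ ¬ P.IsEdgeOf u v ∧
    openSegment ℝ u v ⊆ P.interiorRegion

/-- The set `V(S)` of endpoints of a family of segments, each given by its pair of
endpoints. -/
def endpointSet (S : Finset (Pt × Pt)) : Set Pt :=
  {p | ∃ s ∈ S, p = s.1 ∨ p = s.2}

/-- `P` is a circumscribing polygon of `S`: the vertex set of `P` is `V(S)` and every
segment of `S` is an edge or an internal diagonal of `P`. -/
def Circumscribes (P : SimplePolygon) (S : Finset (Pt × Pt)) : Prop :=
  Set.range P.verts = endpointSet S ∧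
  ∀ s ∈ S, P.IsEdgeOf s.1 s.2 ∨ P.IsInternalDiagonal s.1 s.2

/-- The segments of `S` are nondegenerate and pairwise disjoint. -/
def PairwiseDisjointSegs (S : Finset (Pt × Pt)) : Prop :=
  (∀ s ∈ S, s.1 ≠ s.2) ∧
  ∀ s ∈ S, ∀ t ∈ S, s ≠ t →
    Disjoint (segment ℝ s.1 s.2) (segment ℝ t.1 t.2)

/-- All `2|S|` endpoints of the segments of `S` are distinct. -/
def DistinctEndpoints (S : Finset (Pt × Pt)) : Prop :=
  ∀ s ∈ S, ∀ t ∈ S, s.1 ≠ t.2 ∧ (s ≠ t → s.1 ≠ t.1 ∧ s.2 ≠ t.2)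

open Filter Topology

/-- The plane identified with the complex numbers. -/
noncomputable def toComplex : Pt ≃L[ℝ] ℂ := Complex.equivRealProdCLM.symm

/-- The oriented angle, in `(-π, π]`, under which the segment from `a` to `b` is seen
from `x`. -/
noncomputable def viewAngle (a b x : Pt) : ℝ :=
  Complex.arg (toComplex (b - x) / toComplex (a - x))

lemma toComplex_sub_ne_zero {a x : Pt} (h : x ≠ a) : toComplex (a - x) ≠ 0 := by
  simpa [sub_eq_zero] using h.symm

lemma ne_left_of_notMem_segment {a b x : Pt} (h : x ∉ segment ℝ a b) : x ≠ a :=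
  fun e => h (e ▸ left_mem_segment ℝ a b)

lemma div_mem_slitPlane {a b x : Pt} (h : x ∉ segment ℝ a b) :
    toComplex (b - x) / toComplex (a - x) ∈ Complex.slitPlane := by
  by_contra hs
  set z := toComplex (b - x) / toComplex (a - x) with hz
  rw [Complex.mem_slitPlane_iff, not_or, not_lt, not_not] at hs
  have hza : toComplex (b - x) = z.re • toComplex (a - x) := by
    have hre : z = (z.re : ℂ) := by
      apply Complex.ext <;> simp [hs.2]
    rw [Complex.real_smul, ← hre, hz,
      div_mul_cancel₀ _ (toComplex_sub_ne_zero (ne_left_of_notMem_segment h))]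
  rw [← map_smul] at hza
  have hab : b - x = z.re • (a - x) := toComplex.injective hza
  apply h
  have h1 : 0 < 1 - z.re := by linarith [hs.1]
  refine ⟨-z.re / (1 - z.re), 1 / (1 - z.re), div_nonneg (by linarith [hs.1]) h1.le,
    by positivity, by field_simp; ring, ?_⟩
  have e1 := congrArg Prod.fst hab
  have e2 := congrArg Prod.snd hab
  simp only [Prod.fst_sub, Prod.snd_sub, Prod.smul_fst, Prod.smul_snd, smul_eq_mul] at e1 e2
  ext
  · simp only [Prod.fst_add, Prod.smul_fst, smul_eq_mul]
    field_simp
    linarith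
  · simp only [Prod.snd_add, Prod.smul_snd, smul_eq_mul]
    field_simp
    linarith

lemma continuousAt_viewAngle {a b x : Pt} (h : x ∉ segment ℝ a b) :
    ContinuousAt (viewAngle a b) x := by
  have h1 : ContinuousAt (fun y : Pt => toComplex (b - y) / toComplex (a - y)) x :=
    ContinuousAt.div (by fun_prop) (by fun_prop)
      (toComplex_sub_ne_zero (ne_left_of_notMem_segment h))
  exact ContinuousAt.comp (f := fun y : Pt => toComplex (b - y) / toComplex (a - y))
    (Complex.continuousAt_arg (div_mem_slitPlane h)) h1

lemma viewAngle_swap {a b x : Pt} (h : x ∉ segment ℝ a b) :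
    viewAngle b a x = -viewAngle a b x := by
  unfold viewAngle
  rw [← inv_div, Complex.arg_inv, if_neg]
  exact (Complex.mem_slitPlane_iff_arg.1 (div_mem_slitPlane h)).1

lemma tendsto_viewAngle_cobounded (a b : Pt) :
    Tendsto (viewAngle a b) (Bornology.cobounded Pt) (𝓝 0) := by
  have h0 : Tendsto (fun x : Pt => a - x) (Bornology.cobounded Pt) (Bornology.cobounded Pt) := by
    rw [← tendsto_norm_atTop_iff_cobounded]
    have h := tendsto_atTop_add_const_right _ (-‖a‖) (tendsto_norm_cobounded_atTop (E := Pt))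
    refine tendsto_atTop_mono (fun x => ?_) h
    have := norm_sub_norm_le x a
    rw [norm_sub_rev] at this
    linarith
  have h1 : Tendsto (fun x : Pt => toComplex (a - x)) (Bornology.cobounded Pt)
      (Bornology.cobounded ℂ) :=
    (toComplex.antilipschitz.tendsto_cobounded).comp h0
  have h2 : Tendsto (fun x : Pt => 1 + toComplex (b - a) * (toComplex (a - x))⁻¹)
      (Bornology.cobounded Pt) (𝓝 1) := by
    simpa using ((tendsto_inv₀_cobounded.comp h1).const_mul (toComplex (b - a))).const_add 1
  have h3 : Tendsto (fun x : Pt => toComplex (b - x) / toComplex (a - x))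
      (Bornology.cobounded Pt) (𝓝 1) := by
    refine h2.congr' ?_
    have hne : ∀ᶠ x : Pt in Bornology.cobounded Pt, x ≠ a :=
      (Bornology.isBounded_singleton (x := a))
    filter_upwards [hne] with x hx
    have := toComplex_sub_ne_zero hx
    field_simp
    rw [← map_add]
    congr 1
    abel
  have := (Complex.continuousAt_arg Complex.one_mem_slitPlane).tendsto.comp h3
  rwa [Complex.arg_one] at this

lemma exp_viewAngle_mul_norm (a b x : Pt) :
    Complex.exp (viewAngle a b x * Complex.I) * (‖toComplex (b - x) / toComplex (a - x)‖ : ℂ) =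
      toComplex (b - x) / toComplex (a - x) := by
  rw [mul_comm]
  exact Complex.norm_mul_exp_arg_mul_I _

/-- Seen from points on the two sides of its midpoint, the angle of a segment jumps by `2π`. -/
lemma tendsto_viewAngle_jump {a d : Pt} (hd : d ≠ 0) :
    Tendsto (fun t : ℝ => viewAngle (a - d) (a + d) (a + t • (-d.2, d.1)) -
      viewAngle (a - d) (a + d) (a + (-t) • (-d.2, d.1))) (𝓝[>] 0) (𝓝 (2 * Real.pi)) := by
  have key : ∀ t : ℝ, viewAngle (a - d) (a + d) (a + t • (-d.2, d.1)) =
      Complex.arg ((1 - t * Complex.I) / (-1 - t * Complex.I)) := by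
    intro t
    have hd' : toComplex d ≠ 0 := by simpa using hd
    have hJ : toComplex (-d.2, d.1) = Complex.I * toComplex d := by
      apply Complex.ext <;> simp [toComplex]
    have e1 : toComplex (a + d - (a + t • (-d.2, d.1))) =
        toComplex d * (1 - t * Complex.I) := by
      rw [show a + d - (a + t • ((-d.2, d.1) : Pt)) = d - t • ((-d.2, d.1) : Pt) by abel,
        map_sub, map_smul, hJ, Complex.real_smul]
      ring
    have e2 : toComplex (a - d - (a + t • (-d.2, d.1))) =
        toComplex d * (-1 - t * Complex.I) := by
      rw [show a - d - (a + t • ((-d.2, d.1) : Pt)) = -d - t • ((-d.2, d.1) : Pt) by abel,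
        map_sub, map_smul, hJ, Complex.real_smul, map_neg]
      ring
    rw [viewAngle, e1, e2, mul_div_mul_left _ _ hd']
  have hne : ∀ t : ℝ, (-1 - t * Complex.I : ℂ) ≠ 0 := by
    intro t h
    simpa using congrArg Complex.re h
  have him : ∀ t : ℝ, ((1 - t * Complex.I) / (-1 - t * Complex.I) : ℂ).im =
      2 * t / (1 + t ^ 2) := by
    intro t
    have : (1 + t * t) ≠ 0 := by nlinarith [mul_self_nonneg t]
    have : (1 + t ^ 2) ≠ 0 := by positivity
    simp [Complex.div_im, Complex.normSq_apply]
    field_simp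
    ring
  have hconj : ∀ t : ℝ, 0 < t →
      Complex.arg ((1 - (-t : ℝ) * Complex.I) / (-1 - (-t : ℝ) * Complex.I)) =
      -Complex.arg ((1 - t * Complex.I) / (-1 - t * Complex.I)) := by
    intro t ht
    have : ((1 - (-t : ℝ) * Complex.I) / (-1 - (-t : ℝ) * Complex.I) : ℂ) =
        (starRingEnd ℂ) ((1 - t * Complex.I) / (-1 - t * Complex.I)) := by
      simp
    rw [this, Complex.arg_conj, if_neg]
    intro hpi
    have h2 := (Complex.arg_eq_pi_iff.1 hpi).2
    rw [him] at h2
    have : 0 < 2 * t / (1 + t ^ 2) := by positivity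
    linarith
  have hlim : Tendsto (fun t : ℝ => Complex.arg ((1 - t * Complex.I) / (-1 - t * Complex.I)))
      (𝓝[>] 0) (𝓝 Real.pi) := by
    have h1 := Complex.tendsto_arg_nhdsWithin_im_nonneg_of_re_neg_of_im_zero
      (z := (1 - (0 : ℝ) * Complex.I) / (-1 - (0 : ℝ) * Complex.I)) (by simp) (by simp)
    refine h1.comp (tendsto_nhdsWithin_iff.2 ⟨?_, ?_⟩)
    · have hc : ContinuousAt (fun t : ℝ => ((1 - t * Complex.I) / (-1 - t * Complex.I) : ℂ)) 0 :=
        ContinuousAt.div (by fun_prop) (by fun_prop) (hne 0)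
      exact hc.tendsto.mono_left nhdsWithin_le_nhds
    · filter_upwards [self_mem_nhdsWithin] with t ht
      rw [mem_Ioi] at ht
      rw [him]
      positivity
  have := hlim.add hlim
  rw [← two_mul] at this
  refine this.congr' ?_
  filter_upwards [self_mem_nhdsWithin] with t ht
  rw [key, key, hconj t ht, sub_neg_eq_add]

/-- A set is locally two-sided at `p` if it cuts some neighbourhood of `p` into two connected
pieces, both of which accumulate at every point of the set in that neighbourhood. -/
def LocallyTwoSided (C : Set Pt) (p : Pt) : Prop :=
  ∃ N S T : Set Pt, IsOpen N ∧ p ∈ N ∧ N \ C = S ∪ T ∧ IsPreconnected S ∧ IsPreconnected T ∧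
    C ∩ N ⊆ closure S ∧ C ∩ N ⊆ closure T

lemma mem_closure_of_ray {S N : Set Pt} {q z : Pt} (hN : N ∈ 𝓝 q)
    (h : ∀ t : ℝ, 0 < t → q + t • z ∈ N → q + t • z ∈ S) : q ∈ closure S := by
  have hc : Tendsto (fun t : ℝ => q + t • z) (𝓝[>] 0) (𝓝 q) := by
    have : ContinuousAt (fun t : ℝ => q + t • z) 0 := by fun_prop
    have := this.tendsto
    simp only [zero_smul, add_zero] at this
    exact this.mono_left nhdsWithin_le_nhds
  refine mem_closure_of_tendsto hc ?_
  filter_upwards [self_mem_nhdsWithin, hc hN] with t ht htN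
  exact h t ht htN

lemma locallyTwoSided_of_functionals {C : Set Pt} {p z : Pt} (s t : Pt →L[ℝ] ℝ)
    (hs : s z < 0) (ht : t z < 0)
    (h : ∀ᶠ x in 𝓝 p, x ∈ C ↔ (t (x - p) = 0 ∧ 0 ≤ s (x - p)) ∨
      (s (x - p) = 0 ∧ 0 ≤ t (x - p))) : LocallyTwoSided C p := by
  obtain ⟨r, hr, hball⟩ := Metric.eventually_nhds_iff_ball.1 h
  have conv : ∀ f : Pt →L[ℝ] ℝ, Convex ℝ {x | 0 < f (x - p)} ∧ Convex ℝ {x | f (x - p) < 0} := by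
    intro f
    simp only [map_sub, sub_pos, sub_neg]
    exact ⟨convex_halfSpace_gt f.toLinearMap.isLinear _,
      convex_halfSpace_lt f.toLinearMap.isLinear _⟩
  have hb := convex_ball p r
  refine ⟨Metric.ball p r,
    Metric.ball p r ∩ {x | 0 < s (x - p)} ∩ {x | 0 < t (x - p)},
    Metric.ball p r ∩ {x | s (x - p) < 0} ∪ Metric.ball p r ∩ {x | t (x - p) < 0},
    Metric.isOpen_ball, Metric.mem_ball_self hr, ?_, ?_, ?_, ?_, ?_⟩
  · ext x
    simp only [Set.mem_sdiff, mem_union, mem_inter_iff, mem_ofPred_eq]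
    constructor
    · rintro ⟨hx, hxC⟩
      rw [hball x hx] at hxC
      push Not at hxC
      rcases lt_trichotomy (s (x - p)) 0 with h1 | h1 | h1
      · exact Or.inr (Or.inl ⟨hx, h1⟩)
      · exact Or.inr (Or.inr ⟨hx, hxC.2 h1⟩)
      · rcases lt_trichotomy (t (x - p)) 0 with h2 | h2 | h2
        · exact Or.inr (Or.inr ⟨hx, h2⟩)
        · exact Or.inr (Or.inl ⟨hx, hxC.1 h2⟩)
        · exact Or.inl ⟨⟨hx, h1⟩, h2⟩
    · rintro (⟨⟨hx, h1⟩, h2⟩ | ⟨hx, h1⟩ | ⟨hx, h1⟩) <;> refine ⟨hx, ?_⟩ <;> rw [hball x hx] <;>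
        push Not <;> constructor <;> intro <;> linarith
  · exact ((hb.inter (conv s).1).inter (conv t).1).isPreconnected
  · have hp : p ∈ closure (Metric.ball p r ∩ ({x | s (x - p) < 0} ∩ {x | t (x - p) < 0})) := by
      refine mem_closure_of_ray (Metric.ball_mem_nhds p hr) (z := z) fun c hc hcN => ⟨hcN, ?_⟩
      simp only [mem_inter_iff, mem_ofPred_eq, add_sub_cancel_left, map_smul, smul_eq_mul]
      exact ⟨mul_neg_of_pos_of_neg hc hs, mul_neg_of_pos_of_neg hc ht⟩
    obtain ⟨x, hx, hxs, hxt⟩ := closure_nonempty_iff.1 ⟨p, hp⟩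
    exact IsPreconnected.union x ⟨hx, hxs⟩ ⟨hx, hxt⟩ (hb.inter (conv s).2).isPreconnected
      (hb.inter (conv t).2).isPreconnected
  · rintro q ⟨hqC, hqN⟩
    rw [hball q hqN] at hqC
    refine mem_closure_of_ray (Metric.isOpen_ball.mem_nhds hqN) (z := -z) fun c hc hcN => ?_
    have hs' := mul_pos hc (neg_pos.2 hs)
    have ht' := mul_pos hc (neg_pos.2 ht)
    simp only [mem_inter_iff, mem_ofPred_eq, add_sub_right_comm, map_add, map_smul, map_neg,
      smul_eq_mul]
    refine ⟨⟨hcN, ?_⟩, ?_⟩ <;> rcases hqC with ⟨h1, h2⟩ | ⟨h1, h2⟩ <;> linarith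
  · rintro q ⟨hqC, hqN⟩
    rw [hball q hqN] at hqC
    refine mem_closure_of_ray (Metric.isOpen_ball.mem_nhds hqN) (z := z) fun c hc hcN => ?_
    have hs' := mul_neg_of_pos_of_neg hc hs
    have ht' := mul_neg_of_pos_of_neg hc ht
    simp only [mem_union, mem_inter_iff, mem_ofPred_eq, add_sub_right_comm, map_add, map_smul,
      smul_eq_mul]
    rcases hqC with ⟨h1, h2⟩ | ⟨h1, h2⟩
    · exact Or.inr ⟨hcN, by linarith⟩
    · exact Or.inl ⟨hcN, by linarith⟩

lemma eventually_mem_segment_iff {p a : Pt} (ha : a ≠ 0) :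
    ∀ᶠ x in 𝓝 p, x ∈ segment ℝ p (p + a) ↔ ∃ c : ℝ, 0 ≤ c ∧ x - p = c • a := by
  filter_upwards [Metric.ball_mem_nhds p (norm_pos_iff.2 ha)] with x hx
  rw [segment_eq_image']
  constructor
  · rintro ⟨c, hc, rfl⟩
    exact ⟨c, hc.1, by simp⟩
  · rintro ⟨c, hc, h⟩
    refine ⟨c, ⟨hc, ?_⟩, ?_⟩
    · rw [mem_ball_iff_norm, h, norm_smul, Real.norm_of_nonneg hc] at hx
      have := norm_pos_iff.2 ha
      by_contra! h1
      nlinarith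
    · simp [← h]

/-- The planar cross product with a fixed vector. -/
noncomputable def crossCLM (a : Pt) : Pt →L[ℝ] ℝ :=
  a.1 • ContinuousLinearMap.snd ℝ ℝ ℝ - a.2 • ContinuousLinearMap.fst ℝ ℝ ℝ

lemma crossCLM_apply (a x : Pt) : crossCLM a x = a.1 * x.2 - a.2 * x.1 := by
  simp [crossCLM]

lemma sq_add_sq_pos_of_ne_zero {a : Pt} (ha : a ≠ 0) : 0 < a.1 ^ 2 + a.2 ^ 2 := by
  by_contra! h
  apply ha
  ext
  · simp only [Prod.fst_zero]
    nlinarith [sq_nonneg a.1, sq_nonneg a.2]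
  · simp only [Prod.snd_zero]
    nlinarith [sq_nonneg a.1, sq_nonneg a.2]

lemma exists_smul_of_cross_eq_zero {a x : Pt} (ha : a ≠ 0) (h : crossCLM a x = 0) :
    ∃ c : ℝ, x = c • a := by
  have hpos := sq_add_sq_pos_of_ne_zero ha
  rw [crossCLM_apply] at h
  refine ⟨(a.1 * x.1 + a.2 * x.2) / (a.1 ^ 2 + a.2 ^ 2), ?_⟩
  ext
  · simp only [Prod.smul_fst, smul_eq_mul]
    field_simp
    linear_combination (-a.2) * h
  · simp only [Prod.smul_snd, smul_eq_mul]
    field_simp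
    linear_combination a.1 * h

/-- Two segments leaving `p` in different directions cut a small disc around `p` in two. -/
lemma locallyTwoSided_of_segments {p a b : Pt} {K : Set Pt} (ha : a ≠ 0) (hb : b ≠ 0)
    (hK : IsClosed K) (hpK : p ∉ K)
    (hab : crossCLM a b ≠ 0 ∨ ∃ κ : ℝ, 0 < κ ∧ b = -(κ • a)) :
    LocallyTwoSided (segment ℝ p (p + a) ∪ segment ℝ p (p + b) ∪ K) p := by
  have hC : ∀ᶠ x in 𝓝 p, x ∈ segment ℝ p (p + a) ∪ segment ℝ p (p + b) ∪ K ↔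
      (∃ c : ℝ, 0 ≤ c ∧ x - p = c • a) ∨ (∃ c : ℝ, 0 ≤ c ∧ x - p = c • b) := by
    filter_upwards [eventually_mem_segment_iff (p := p) ha, eventually_mem_segment_iff (p := p) hb,
      hK.isOpen_compl.mem_nhds hpK] with x h1 h2 h3
    rw [mem_union, mem_union, h1, h2, or_iff_left h3]
  have self : ∀ v : Pt, crossCLM v v = 0 := fun v => by rw [crossCLM_apply]; ring
  rcases hab with hab | ⟨κ, hκ, rfl⟩
  · have hba : crossCLM b a = -crossCLM a b := by
      rw [crossCLM_apply, crossCLM_apply]; ring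
    refine locallyTwoSided_of_functionals (z := -a - b) (-(crossCLM a b)⁻¹ • crossCLM b)
      ((crossCLM a b)⁻¹ • crossCLM a) ?_ ?_ ?_
    · simp [self, hba, hab]
    · simp [self, hab]
    · filter_upwards [hC] with x hx
      rw [hx]
      generalize x - p = y
      have hdec : y = (-(crossCLM a b)⁻¹ * crossCLM b y) • a +
          ((crossCLM a b)⁻¹ * crossCLM a y) • b := by
        have h' := hab
        rw [crossCLM_apply] at h'
        simp only [crossCLM_apply]
        ext
        · simp only [Prod.fst_add, Prod.smul_fst, smul_eq_mul]
          field_simp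
          ring
        · simp only [Prod.snd_add, Prod.smul_snd, smul_eq_mul]
          field_simp
          ring
      simp only [smul_apply, smul_eq_mul]
      constructor
      · rintro (⟨c, hc, rfl⟩ | ⟨c, hc, rfl⟩)
        · left
          simp only [map_smul, self, hba, smul_eq_mul]
          refine ⟨by simp, ?_⟩
          field_simp
          exact hc
        · right
          simp only [map_smul, self, smul_eq_mul]
          refine ⟨by simp, ?_⟩
          field_simp
          exact hc
      · rintro (⟨h1, h2⟩ | ⟨h1, h2⟩) <;> rw [h1] at hdec
        · exact Or.inl ⟨_, h2, by simpa using hdec⟩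
        · exact Or.inr ⟨_, h2, by simpa using hdec⟩
  · have hz : crossCLM a (a.2, -a.1) < 0 := by
      have := sq_add_sq_pos_of_ne_zero ha
      rw [crossCLM_apply]
      dsimp only
      linarith
    refine locallyTwoSided_of_functionals (crossCLM a) (crossCLM a) hz hz ?_
    filter_upwards [hC] with x hx
    rw [hx]
    constructor
    · rintro (⟨c, hc, h⟩ | ⟨c, hc, h⟩) <;> rw [h] <;> simp [self]
    · intro h
      obtain ⟨c, hc⟩ := exists_smul_of_cross_eq_zero ha (x := x - p) (by tauto)
      rw [hc]
      rcases le_total 0 c with h0 | h0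
      · exact Or.inl ⟨c, h0, rfl⟩
      · refine Or.inr ⟨-c / κ, div_nonneg (by linarith) hκ.le, ?_⟩
        rw [smul_neg, smul_smul, div_mul_cancel₀ _ hκ.ne', neg_smul, neg_neg]

/-- Every complementary component of a connected, locally two-sided closed set accumulates
at all of its points. -/
lemma subset_closure_connectedComponentIn {C : Set Pt} (hC : IsClosed C) (hne : C.Nonempty)
    (hconn : IsPreconnected C) (htwo : ∀ p ∈ C, LocallyTwoSided C p) {x : Pt} (hx : x ∉ C) :
    C ⊆ closure (connectedComponentIn Cᶜ x) := by
  set U := connectedComponentIn Cᶜ x with hU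
  have hxU : x ∈ U := mem_connectedComponentIn hx
  have hUC : U ⊆ Cᶜ := connectedComponentIn_subset _ _
  have hmeet : (C ∩ closure U).Nonempty := by
    by_contra hemp
    have hcl : closure U ⊆ Cᶜ := fun y hy hyC => hemp ⟨y, hyC, hy⟩
    have hsub : closure U ⊆ U :=
      isPreconnected_connectedComponentIn.closure.subset_connectedComponentIn
        (subset_closure hxU) hcl
    have hclopen : IsClopen U :=
      ⟨closure_subset_iff_isClosed.1 hsub, hC.isOpen_compl.connectedComponentIn⟩
    have := hclopen.eq_univ ⟨x, hxU⟩
    obtain ⟨c, hc⟩ := hne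
    exact hUC (this ▸ mem_univ c) hc
  set O : Set Pt := ⋃₀ {N | IsOpen N ∧ C ∩ N ⊆ closure U} with hO
  have hlocal : ∀ p ∈ C, p ∈ closure U → p ∈ O := by
    intro p hp hpU
    obtain ⟨N, S, T, hN, hpN, hST, hS, hT, hCS, hCT⟩ := htwo p hp
    refine ⟨N, ⟨hN, ?_⟩, hpN⟩
    obtain ⟨y, hyN, hyU⟩ := mem_closure_iff.1 hpU N hN hpN
    have hyC : y ∉ C := hUC hyU
    have hUy : U = connectedComponentIn Cᶜ y := connectedComponentIn_eq hyU
    have hsub : S ∪ T ⊆ Cᶜ := hST ▸ fun z hz => hz.2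
    have hyST : y ∈ S ∪ T := hST ▸ ⟨hyN, hyC⟩
    rcases hyST with hy | hy
    · refine hCS.trans (closure_mono ?_)
      rw [hUy]
      exact hS.subset_connectedComponentIn hy (subset_union_left.trans hsub)
    · refine hCT.trans (closure_mono ?_)
      rw [hUy]
      exact hT.subset_connectedComponentIn hy (subset_union_right.trans hsub)
  intro q hq
  by_contra hqU
  obtain ⟨p, hp, hpU⟩ := hmeet
  obtain ⟨y, hy, ⟨N, ⟨-, hN⟩, hyN⟩, hyU⟩ := hconn O (closure U)ᶜ
    (isOpen_sUnion fun N hN => hN.1) isClosed_closure.isOpen_compl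
    (fun y hy => (em (y ∈ closure U)).imp (hlocal y hy) id)
    ⟨p, hp, hlocal p hp hpU⟩ ⟨q, hq, hqU⟩
  exact hyU (hN ⟨hy, hyN⟩)

lemma isCompact_segment (a b : Pt) : IsCompact (segment ℝ a b) := by
  rw [segment_eq_image']
  exact isCompact_Icc.image (by fun_prop)

lemma eq_of_isPreconnected_of_int_mul {S : Set Pt} (hS : IsPreconnected S) {f : Pt → ℝ} {c : ℝ}
    (hc : 0 < c) (hf : ContinuousOn f S) (hvals : ∀ x ∈ S, ∃ k : ℤ, f x = k * c) {x y : Pt}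
    (hx : x ∈ S) (hy : y ∈ S) : f x = f y := by
  have key : ∀ x ∈ S, ∀ y ∈ S, ¬ f x < f y := by
    intro x hx y hy hlt
    obtain ⟨k, hk⟩ := hvals x hx
    obtain ⟨l, hl⟩ := hvals y hy
    rw [hk, hl] at hlt
    have hkl : k + 1 ≤ l := by exact_mod_cast lt_of_mul_lt_mul_right hlt hc.le
    have hkl' : (k + 1 : ℝ) ≤ l := by exact_mod_cast hkl
    obtain ⟨z, hz, hzf⟩ := (hS.image f hf).Icc_subset (mem_image_of_mem f hx)
      (mem_image_of_mem f hy)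
      (show (k + 1 / 2 : ℝ) * c ∈ Icc (f x) (f y) from ⟨by rw [hk]; nlinarith, by rw [hl]; nlinarith⟩)
    obtain ⟨m, hm⟩ := hvals z hz
    have h2 : (m : ℝ) = k + 1 / 2 := mul_right_cancel₀ hc.ne' (hm.symm.trans hzf)
    have h3 : ((2 * m : ℤ) : ℝ) = ((2 * k + 1 : ℤ) : ℝ) := by push_cast; linarith
    have h4 : 2 * m = 2 * k + 1 := by exact_mod_cast h3
    omega
  exact le_antisymm (not_lt.1 (key y hy x hx)) (not_lt.1 (key x hx y hy))

lemma segment_eq_union_of_mem {a b p : Pt} (hp : p ∈ segment ℝ a b) :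
    segment ℝ a b = segment ℝ p a ∪ segment ℝ p b := by
  rw [segment_eq_image_lineMap] at hp
  obtain ⟨t, ht, rfl⟩ := hp
  have h := fun s r : ℝ => image_segment ℝ (AffineMap.lineMap (k := ℝ) a b) s r
  have h0 := h t 0
  have h1 := h t 1
  have h2 := h 0 1
  rw [AffineMap.lineMap_apply_zero] at h0 h2
  rw [AffineMap.lineMap_apply_one] at h1 h2
  rw [← h0, ← h1, ← h2, ← image_union, segment_symm ℝ t 0, segment_eq_Icc ht.1,
    segment_eq_Icc ht.2, segment_eq_Icc zero_le_one, Icc_union_Icc_eq_Icc ht.1 ht.2]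

namespace SimplePolygon

variable (P : SimplePolygon)

instance : NeZero P.n := ⟨by have := P.three_le; omega⟩

/-- The edge of a polygon starting at the given vertex. -/
def edge (i : ZMod P.n) : Set Pt := segment ℝ (P.verts i) (P.verts (i + 1))

lemma edge_subset_boundary (i : ZMod P.n) : P.edge i ⊆ P.boundary :=
  subset_iUnion (fun i => segment ℝ (P.verts i) (P.verts (i + 1))) i

lemma verts_mem_boundary (i : ZMod P.n) : P.verts i ∈ P.boundary :=
  P.edge_subset_boundary i (left_mem_segment ℝ _ _)

lemma natCast_injOn {a b : ℕ} (ha : a < P.n) (hb : b < P.n) (h : (a : ZMod P.n) = b) :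
    a = b := by
  rw [ZMod.natCast_eq_natCast_iff', Nat.mod_eq_of_lt ha, Nat.mod_eq_of_lt hb] at h
  exact h

lemma add_one_ne (i : ZMod P.n) : i + 1 ≠ i := by
  have := P.three_le
  intro h
  have h0 : ((1 : ℕ) : ZMod P.n) = (0 : ℕ) := by simpa using h
  exact absurd (P.natCast_injOn (by omega) (by omega) h0) (by omega)

lemma add_one_add_one_ne (i : ZMod P.n) : i + 1 + 1 ≠ i := by
  have := P.three_le
  intro h
  have h0 : ((2 : ℕ) : ZMod P.n) = (0 : ℕ) := by
    rw [add_assoc, add_eq_left, one_add_one_eq_two] at h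
    exact_mod_cast h
  exact absurd (P.natCast_injOn (by omega) (by omega) h0) (by omega)

lemma verts_mem_edge {i j : ZMod P.n} (h : P.verts i ∈ P.edge j) : i = j ∨ i = j + 1 := by
  by_contra! hij
  have hi : P.verts i ∈ P.edge i := left_mem_segment ℝ _ _
  by_cases hji : j = i + 1
  · subst hji
    have : P.verts i ∈ ({P.verts (i + 1)} : Set Pt) := P.edges_adj i ▸ ⟨hi, h⟩
    exact P.add_one_ne i (P.inj this).symm
  · have : P.verts i ∈ (∅ : Set Pt) :=
      P.edges_nonadj i j hij.1.symm hji hij.2 ▸ ⟨hi, h⟩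
    exact this

lemma eq_verts_of_mem_edge_of_mem_edge {i j : ZMod P.n} {x : Pt} (hi : x ∈ P.edge i)
    (hj : x ∈ P.edge j) (hij : i ≠ j) : x = P.verts i ∨ x = P.verts (i + 1) := by
  by_cases h1 : j = i + 1
  · subst h1
    exact Or.inr (P.edges_adj i ▸ ⟨hi, hj⟩ : x ∈ ({P.verts (i + 1)} : Set Pt))
  by_cases h2 : i = j + 1
  · subst h2
    exact Or.inl (P.edges_adj j ▸ ⟨hj, hi⟩ : x ∈ ({P.verts (j + 1)} : Set Pt))
  · have : x ∈ (∅ : Set Pt) := P.edges_nonadj i j hij.symm h1 h2 ▸ ⟨hi, hj⟩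
    exact this.elim

lemma isCompact_boundary : IsCompact P.boundary :=
  isCompact_iUnion fun _ => isCompact_segment _ _

lemma isClosed_iUnion_edge (p : ZMod P.n → Prop) : IsClosed (⋃ j, ⋃ _ : p j, P.edge j) :=
  isClosed_iUnion_of_finite fun _ => isClosed_iUnion_of_finite fun _ =>
    (isCompact_segment _ _).isClosed

lemma isPreconnected_boundary : IsPreconnected P.boundary := by
  refine IsPreconnected.iUnion_of_reflTransGen (fun i => (convex_segment _ _).isPreconnected) ?_
  have step : ∀ (i : ZMod P.n) (m : ℕ), Relation.ReflTransGen (fun i j : ZMod P.n =>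
      (segment ℝ (P.verts i) (P.verts (i + 1)) ∩
        segment ℝ (P.verts j) (P.verts (j + 1))).Nonempty) i (i + m) := by
    intro i m
    induction m with
    | zero => simpa using Relation.ReflTransGen.refl
    | succ m ih =>
      refine ih.tail ⟨P.verts (i + m + 1), right_mem_segment ℝ _ _, ?_⟩
      rw [Nat.cast_succ, ← add_assoc]
      exact left_mem_segment ℝ _ _
  intro i j
  simpa using step i (j - i).val

lemma locallyTwoSided_boundary {p : Pt} (hp : p ∈ P.boundary) :
    LocallyTwoSided P.boundary p := by
  obtain ⟨i, hi⟩ := mem_iUnion.1 hp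
  by_cases hv : p ∈ range P.verts
  · obtain ⟨i, rfl⟩ := hv
    obtain ⟨j, rfl⟩ : ∃ j, i = j + 1 := ⟨i - 1, by simp⟩
    have hC : P.boundary = segment ℝ (P.verts (j + 1))
          (P.verts (j + 1) + (P.verts j - P.verts (j + 1))) ∪
        segment ℝ (P.verts (j + 1))
          (P.verts (j + 1) + (P.verts (j + 1 + 1) - P.verts (j + 1))) ∪
        ⋃ k, ⋃ _ : k ≠ j ∧ k ≠ j + 1, P.edge k := by
      rw [add_sub_cancel, add_sub_cancel, segment_symm ℝ (P.verts (j + 1)) (P.verts j)]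
      apply Subset.antisymm
      · refine iUnion_subset fun k x hx => ?_
        by_cases h1 : k = j
        · exact Or.inl (Or.inl (h1 ▸ hx))
        by_cases h2 : k = j + 1
        · exact Or.inl (Or.inr (h2 ▸ hx))
        · exact Or.inr (mem_iUnion₂.2 ⟨k, ⟨h1, h2⟩, hx⟩)
      · exact union_subset (union_subset (P.edge_subset_boundary j)
          (P.edge_subset_boundary (j + 1))) (iUnion₂_subset fun k _ => P.edge_subset_boundary k)
    have hne1 : P.verts j - P.verts (j + 1) ≠ 0 :=
      sub_ne_zero.2 fun h => P.add_one_ne j (P.inj h).symm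
    have hne2 : P.verts (j + 1 + 1) - P.verts (j + 1) ≠ 0 :=
      sub_ne_zero.2 fun h => P.add_one_ne (j + 1) (P.inj h)
    rw [hC]
    refine locallyTwoSided_of_segments hne1 hne2 (P.isClosed_iUnion_edge _) ?_ ?_
    · intro h
      obtain ⟨k, ⟨hk1, hk2⟩, hk⟩ := mem_iUnion₂.1 h
      rcases P.verts_mem_edge hk with h | h
      · exact hk2 h.symm
      · exact hk1 (add_right_cancel h).symm
    · by_contra! hcon
      obtain ⟨hcross, hκ⟩ := hcon
      obtain ⟨c, hc⟩ := exists_smul_of_cross_eq_zero hne1 hcross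
      rcases lt_trichotomy c 0 with h0 | h0 | h0
      · exact hκ (-c) (by linarith) (by rw [hc]; simp)
      · rw [h0, zero_smul] at hc
        exact hne2 hc
      rcases le_total c 1 with h1 | h1
      · have : P.verts (j + 1 + 1) ∈ P.edge j := by
          rw [edge, segment_symm, segment_eq_image']
          exact ⟨c, ⟨h0.le, h1⟩, by simp [← hc]⟩
        rcases P.verts_mem_edge this with h | h
        · exact P.add_one_add_one_ne j h
        · exact P.add_one_ne _ h
      · have : P.verts j ∈ P.edge (j + 1) := by
          rw [edge, segment_eq_image']
          refine ⟨c⁻¹, ⟨by positivity, inv_le_one_of_one_le₀ h1⟩, ?_⟩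
          simp only
          rw [hc, smul_smul, inv_mul_cancel₀ h0.ne', one_smul, add_sub_cancel]
        rcases P.verts_mem_edge this with h | h
        · exact P.add_one_ne j h.symm
        · exact P.add_one_add_one_ne j h.symm
  · have hp1 : P.verts i ≠ p := fun h => hv ⟨i, h⟩
    have hp2 : P.verts (i + 1) ≠ p := fun h => hv ⟨i + 1, h⟩
    obtain ⟨α, β, hα, hβ, hαβ, hsum⟩ := (mem_openSegment_of_ne_left_right hp1 hp2 hi)
    have hC : P.boundary = segment ℝ p (p + (P.verts i - p)) ∪
        segment ℝ p (p + (P.verts (i + 1) - p)) ∪ ⋃ k, ⋃ _ : k ≠ i, P.edge k := by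
      rw [add_sub_cancel, add_sub_cancel, 
        ← segment_eq_union_of_mem hi]
      apply Subset.antisymm
      · refine iUnion_subset fun k x hx => ?_
        by_cases h1 : k = i
        · exact Or.inl (h1 ▸ hx)
        · exact Or.inr (mem_iUnion₂.2 ⟨k, h1, hx⟩)
      · exact union_subset (P.edge_subset_boundary i)
          (iUnion₂_subset fun k _ => P.edge_subset_boundary k)
    rw [hC]
    refine locallyTwoSided_of_segments (sub_ne_zero.2 hp1) (sub_ne_zero.2 hp2)
      (P.isClosed_iUnion_edge _) ?_ (Or.inr ⟨α / β, by positivity, ?_⟩)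
    · intro h
      obtain ⟨k, hk1, hk⟩ := mem_iUnion₂.1 h
      rcases P.eq_verts_of_mem_edge_of_mem_edge hi hk hk1.symm with h | h
      · exact hp1 h.symm
      · exact hp2 h.symm
    · have h1 : α • (P.verts i - p) + β • (P.verts (i + 1) - p) = 0 := by
        rw [smul_sub, smul_sub, sub_add_sub_comm, ← add_smul, hαβ, hsum, one_smul, sub_self]
      apply smul_right_injective Pt hβ.ne'
      simp only
      rw [smul_neg, smul_smul, mul_div_cancel₀ _ hβ.ne']
      exact eq_neg_of_add_eq_zero_right h1

/-- The total angle swept by the boundary of a polygon, as seen from a point. -/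
noncomputable def totalAngle (x : Pt) : ℝ :=
  ∑ i : ZMod P.n, viewAngle (P.verts i) (P.verts (i + 1)) x

variable {P}

lemma notMem_segment {x : Pt} (hx : x ∉ P.boundary) (i : ZMod P.n) :
    x ∉ segment ℝ (P.verts i) (P.verts (i + 1)) :=
  fun h => hx (P.edge_subset_boundary i h)

lemma continuousAt_totalAngle {x : Pt} (hx : x ∉ P.boundary) : ContinuousAt P.totalAngle x :=
  tendsto_finsetSum _ fun i _ => continuousAt_viewAngle (notMem_segment hx i)

lemma tendsto_totalAngle_cobounded :
    Tendsto P.totalAngle (Bornology.cobounded Pt) (𝓝 0) := by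
  unfold totalAngle
  simpa using tendsto_finsetSum (Finset.univ : Finset (ZMod P.n)) fun i _ =>
    tendsto_viewAngle_cobounded (P.verts i) (P.verts (i + 1))

lemma exists_totalAngle_eq {x : Pt} (hx : x ∉ P.boundary) :
    ∃ k : ℤ, P.totalAngle x = k * (2 * Real.pi) := by
  set z : ZMod P.n → ℂ := fun i => toComplex (P.verts i - x) with hz
  have hz0 : ∀ i, z i ≠ 0 := fun i =>
    toComplex_sub_ne_zero fun h => hx (h ▸ P.verts_mem_boundary i)
  have hprod : ∏ i, z (i + 1) / z i = 1 := by
    rw [Finset.prod_div_distrib, ← Equiv.prod_comp (Equiv.addRight (1 : ZMod P.n)) z]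
    exact div_self (Finset.prod_ne_zero_iff.2 fun i _ => hz0 _)
  have hexp : Complex.exp (P.totalAngle x * Complex.I) = 1 := by
    have h := Finset.prod_congr rfl fun (i : ZMod P.n) (_ : i ∈ Finset.univ) =>
      exp_viewAngle_mul_norm (P.verts i) (P.verts (i + 1)) x
    rw [Finset.prod_mul_distrib, ← Complex.exp_sum, ← Finset.sum_mul,
      ← Complex.ofReal_sum, ← Complex.ofReal_prod, ← norm_prod] at h
    change Complex.exp (P.totalAngle x * Complex.I) * (‖∏ i, z (i + 1) / z i‖ : ℝ) =
      ∏ i, z (i + 1) / z i at h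
    simpa [hprod] using h
  obtain ⟨k, hk⟩ := Complex.exp_eq_one_iff.1 hexp
  refine ⟨k, ?_⟩
  have := congrArg Complex.im hk
  simpa [mul_assoc] using this

lemma totalAngle_eq_of_isPreconnected {S : Set Pt} (hS : IsPreconnected S)
    (hSP : S ⊆ P.boundaryᶜ) {x y : Pt} (hx : x ∈ S) (hy : y ∈ S) :
    P.totalAngle x = P.totalAngle y :=
  eq_of_isPreconnected_of_int_mul hS Real.two_pi_pos
    (fun _ hz => (continuousAt_totalAngle (hSP hz)).continuousWithinAt)
    (fun _ hz => exists_totalAngle_eq (hSP hz)) hx hy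

lemma totalAngle_eq_zero_of_not_isBounded {x : Pt} (hx : x ∉ P.boundary)
    (hU : ¬ Bornology.IsBounded (connectedComponentIn P.boundaryᶜ x)) : P.totalAngle x = 0 := by
  have hfar : ∀ᶠ y in Bornology.cobounded Pt, |P.totalAngle y| < 2 * Real.pi := by
    have := tendsto_totalAngle_cobounded (P := P) (Metric.ball_mem_nhds 0 Real.two_pi_pos)
    filter_upwards [this] with y hy
    simpa using hy
  have hex : ∃ y ∈ connectedComponentIn P.boundaryᶜ x, |P.totalAngle y| < 2 * Real.pi := by
    by_contra! hcon
    refine hU (Bornology.IsBounded.subset (Bornology.isBounded_def.2 ?_) (t :=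
      {y | |P.totalAngle y| < 2 * Real.pi}ᶜ) fun y hy => not_lt.2 (hcon y hy))
    rw [compl_compl]
    exact hfar
  obtain ⟨y, hy, hlt⟩ := hex
  have hxy := totalAngle_eq_of_isPreconnected isPreconnected_connectedComponentIn
    (connectedComponentIn_subset P.boundaryᶜ x) (mem_connectedComponentIn hx) hy
  rw [hxy]
  obtain ⟨k, hk⟩ := exists_totalAngle_eq (connectedComponentIn_subset P.boundaryᶜ x hy)
  rw [hk, abs_mul, abs_of_pos Real.two_pi_pos] at hlt
  have hk1 : |(k : ℝ)| < 1 := by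
    by_contra! h
    nlinarith [Real.two_pi_pos]
  have hk0 : k = 0 := Int.abs_lt_one_iff.1 (by exact_mod_cast hk1)
  rw [hk, hk0]
  simp

variable (P) in
lemma exists_not_isBounded : ∃ y, y ∉ P.boundary ∧
    ¬ Bornology.IsBounded (connectedComponentIn P.boundaryᶜ y) := by
  obtain ⟨r, hr⟩ := P.isCompact_boundary.isBounded.subset_closedBall 0
  set S : Set Pt := (fun t : ℝ => (t, (0 : ℝ))) '' Ioi (max r 0) with hS
  have hconn : IsPreconnected S := isPreconnected_Ioi.image _ (by fun_prop)
  have hSP : S ⊆ P.boundaryᶜ := by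
    rintro _ ⟨t, ht, rfl⟩ h
    have := hr h
    rw [mem_closedBall_zero_iff, Prod.norm_def] at this
    have h1 : |t| ≤ r := (le_max_left _ _).trans this
    rw [mem_Ioi, max_lt_iff] at ht
    linarith [le_abs_self t]
  have hy : ((max r 0 + 1, 0) : Pt) ∈ S := ⟨_, by simp, rfl⟩
  refine ⟨_, hSP hy, fun hb => ?_⟩
  have hSb := hb.subset (hconn.subset_connectedComponentIn hy hSP)
  obtain ⟨R, hR⟩ := hSb.subset_closedBall 0
  have : ((max R (max r 0) + 1, 0) : Pt) ∈ S :=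
    ⟨max R (max r 0) + 1, mem_Ioi.2 ((le_max_right _ _).trans_lt (lt_add_one _)), rfl⟩
  have := hR this
  rw [mem_closedBall_zero_iff, Prod.norm_def] at this
  have h1 := (le_max_left _ _).trans this
  have h2 := (le_abs_self _).trans h1
  simp only at h2
  linarith [le_max_left R (max r 0)]

variable (P) in
/-- Near the midpoint of an edge, the total angle takes values differing by `2π`. -/
lemma exists_totalAngle_jump : ∃ p ∈ P.boundary, ∀ N ∈ 𝓝 p,
    ∃ x ∈ N \ P.boundary, ∃ y ∈ N \ P.boundary, P.totalAngle x = P.totalAngle y + 2 * Real.pi := by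
  set i : ZMod P.n := 0
  set d : Pt := (1 / 2 : ℝ) • (P.verts (i + 1) - P.verts i) with hd
  set p : Pt := P.verts i + d with hp
  have hne : P.verts (i + 1) - P.verts i ≠ 0 := sub_ne_zero.2 fun h => P.add_one_ne i (P.inj h)
  have hd0 : d ≠ 0 := smul_ne_zero (by norm_num) hne
  have e1 : P.verts i = p - d := by simp [hp]
  have e2 : P.verts (i + 1) = p + d := by
    rw [hp, add_assoc, ← two_smul ℝ d, hd, smul_smul]
    norm_num
  have hpi : p ∈ P.edge i := by
    rw [edge, segment_eq_image']
    exact ⟨1 / 2, by norm_num, rfl⟩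
  have hother : ∀ j, j ≠ i → p ∉ P.edge j := by
    intro j hj h
    rcases P.eq_verts_of_mem_edge_of_mem_edge hpi h hj.symm with h | h
    · exact hd0 (by simpa [hp] using h)
    · exact hd0 (by simpa [e2] using h)
  refine ⟨p, P.edge_subset_boundary i hpi, fun N hN => ?_⟩
  set J : Pt := (-d.2, d.1) with hJ
  have hline : ∀ σ : ℝ, Tendsto (fun t : ℝ => p + (σ * t) • J) (𝓝[>] 0) (𝓝 p) := by
    intro σ
    have : ContinuousAt (fun t : ℝ => p + (σ * t) • J) 0 := by fun_prop
    have := this.tendsto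
    simp only [mul_zero, zero_smul, add_zero] at this
    exact this.mono_left nhdsWithin_le_nhds
  have hmem : ∀ σ : ℝ, σ ≠ 0 → ∀ᶠ t : ℝ in 𝓝[>] 0, p + (σ * t) • J ∈ N \ P.boundary := by
    intro σ hσ
    have hK := (P.isClosed_iUnion_edge (· ≠ i)).isOpen_compl.mem_nhds (x := p) (by
      simp only [mem_compl_iff, mem_iUnion, not_exists]
      exact hother)
    filter_upwards [hline σ hN, hline σ hK, self_mem_nhdsWithin] with t h1 h2 ht
    refine ⟨h1, fun hb => ?_⟩
    obtain ⟨j, hj⟩ := mem_iUnion.1 hb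
    by_cases hji : j = i
    · rw [hji, segment_eq_image', e1, e2] at hj
      obtain ⟨θ, -, hθ⟩ := hj
      have f1 := congrArg Prod.fst hθ
      have f2 := congrArg Prod.snd hθ
      simp [hJ] at f1 f2
      have hpos := sq_add_sq_pos_of_ne_zero hd0
      have : (σ * t) * (d.1 ^ 2 + d.2 ^ 2) = 0 := by
        linear_combination d.2 * f1 - d.1 * f2
      exact mul_ne_zero (mul_ne_zero hσ (ne_of_gt ht)) hpos.ne' this
    · exact h2 (mem_iUnion₂.2 ⟨j, hji, hj⟩)
  have hlim : Tendsto (fun t : ℝ => P.totalAngle (p + t • J) - P.totalAngle (p + (-t) • J))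
      (𝓝[>] 0) (𝓝 (2 * Real.pi)) := by
    have hrest : ∀ j ∈ Finset.univ.erase i, Tendsto (fun t : ℝ =>
        viewAngle (P.verts j) (P.verts (j + 1)) (p + t • J) -
        viewAngle (P.verts j) (P.verts (j + 1)) (p + (-t) • J)) (𝓝[>] 0) (𝓝 0) := by
      intro j hj
      have hc := continuousAt_viewAngle (hother j (Finset.ne_of_mem_erase hj))
      have := (hc.tendsto.comp (hline 1)).sub (hc.tendsto.comp (hline (-1)))
      simpa [Function.comp_def] using this
    have h := (tendsto_viewAngle_jump (a := p) hd0).add (tendsto_finsetSum _ hrest)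
    rw [Finset.sum_const_zero, add_zero, ← e1, ← e2] at h
    refine h.congr fun t => ?_
    rw [totalAngle, totalAngle, ← Finset.sum_sub_distrib,
      ← Finset.add_sum_erase _ _ (Finset.mem_univ i)]
  have hnear := hlim (Metric.ball_mem_nhds _ Real.pi_pos)
  obtain ⟨t, ⟨h1, h2⟩, h3⟩ :=
    (((hmem 1 one_ne_zero).and (hmem (-1) (by norm_num))).and hnear).exists
  rw [one_mul] at h1
  rw [neg_one_mul] at h2
  refine ⟨_, h1, _, h2, ?_⟩
  obtain ⟨k, hk⟩ := exists_totalAngle_eq h1.2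
  obtain ⟨l, hl⟩ := exists_totalAngle_eq h2.2
  beta_reduce at h3
  rw [hk, hl, Real.ball_eq_Ioo, mem_Ioo] at h3
  have hpi' := Real.pi_pos
  have g1 : (0 : ℝ) < k - l := by
    by_contra! h
    nlinarith
  have g2 : (k - l : ℝ) < 2 := by
    by_contra! h
    nlinarith
  have g1' : 0 < k - l := by exact_mod_cast g1
  have g2' : k - l < 2 := by exact_mod_cast g2
  have hkl : k = l + 1 := by omega
  rw [hk, hl, hkl]
  push_cast
  ring

/-- The Jordan curve theorem for polygons, in terms of the total angle. -/
lemma abs_totalAngle_of_isBounded {x : Pt} (hx : x ∉ P.boundary)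
    (hU : Bornology.IsBounded (connectedComponentIn P.boundaryᶜ x)) :
    |P.totalAngle x| = 2 * Real.pi := by
  obtain ⟨y, hy, hV⟩ := P.exists_not_isBounded
  have hy0 := totalAngle_eq_zero_of_not_isBounded hy hV
  obtain ⟨p, hp, hjump⟩ := P.exists_totalAngle_jump
  obtain ⟨N, S, T, hN, hpN, hST, hS, hT, -, -⟩ := P.locallyTwoSided_boundary hp
  obtain ⟨q, hq, r, hr, hqr⟩ := hjump N (hN.mem_nhds hpN)
  rw [hST] at hq hr
  have hsub : S ∪ T ⊆ P.boundaryᶜ := hST ▸ fun z hz => hz.2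
  have hSP := subset_union_left.trans hsub
  have hTP := subset_union_right.trans hsub
  have hpi := Real.two_pi_pos
  have reach : ∀ z, z ∉ P.boundary → (∃ w ∈ S, connectedComponentIn P.boundaryᶜ z =
      connectedComponentIn P.boundaryᶜ w) ∨ (∃ w ∈ T, connectedComponentIn P.boundaryᶜ z =
      connectedComponentIn P.boundaryᶜ w) := by
    intro z hz
    have hcl := subset_closure_connectedComponentIn P.isCompact_boundary.isClosed ⟨p, hp⟩
      P.isPreconnected_boundary (fun _ h => P.locallyTwoSided_boundary h) hz hp
    obtain ⟨w, hwN, hw⟩ := mem_closure_iff.1 hcl N hN hpN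
    have hwST : w ∈ S ∪ T := hST ▸ ⟨hwN, connectedComponentIn_subset _ _ hw⟩
    exact hwST.imp (fun h => ⟨w, h, connectedComponentIn_eq hw⟩)
      (fun h => ⟨w, h, connectedComponentIn_eq hw⟩)
  have angle_eq : ∀ z w, z ∉ P.boundary → w ∉ P.boundary → connectedComponentIn P.boundaryᶜ z =
      connectedComponentIn P.boundaryᶜ w → P.totalAngle z = P.totalAngle w := by
    intro z w hz hw h
    exact totalAngle_eq_of_isPreconnected isPreconnected_connectedComponentIn
      (connectedComponentIn_subset P.boundaryᶜ z) (mem_connectedComponentIn hz)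
      (h ▸ mem_connectedComponentIn hw)
  have same : ∀ A : Set Pt, IsPreconnected A → A ⊆ P.boundaryᶜ → ∀ w ∈ A, ∀ w' ∈ A,
      connectedComponentIn P.boundaryᶜ x = connectedComponentIn P.boundaryᶜ w →
      connectedComponentIn P.boundaryᶜ y = connectedComponentIn P.boundaryᶜ w' → False := by
    intro A hA hAP w hw w' hw' hxw hyw
    apply hV
    rw [hyw, connectedComponentIn_eq (hA.subset_connectedComponentIn hw' hAP hw), ← hxw]
    exact hU
  have hSS : ∀ w ∈ S, ∀ w' ∈ S, P.totalAngle w = P.totalAngle w' := fun w hw w' hw' =>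
    totalAngle_eq_of_isPreconnected hS hSP hw hw'
  have hTT : ∀ w ∈ T, ∀ w' ∈ T, P.totalAngle w = P.totalAngle w' := fun w hw w' hw' =>
    totalAngle_eq_of_isPreconnected hT hTP hw hw'
  have cross : ∀ w ∈ S, ∀ w' ∈ T, |P.totalAngle w - P.totalAngle w'| = 2 * Real.pi := by
    intro w hw w' hw'
    rcases hq with hq | hq <;> rcases hr with hr | hr
    · linarith [hSS q hq r hr]
    · rw [hSS w hw q hq, hTT w' hw' r hr, hqr, add_sub_cancel_left, abs_of_pos hpi]
    · rw [hSS w hw r hr, hTT w' hw' q hq, hqr, sub_add_cancel_left, abs_neg, abs_of_pos hpi]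
    · linarith [hTT q hq r hr]
  rcases reach x hx with ⟨w, hw, hxw⟩ | ⟨w, hw, hxw⟩ <;>
    rcases reach y hy with ⟨w', hw', hyw⟩ | ⟨w', hw', hyw⟩
  · exact (same S hS hSP w hw w' hw' hxw hyw).elim
  · have := cross w hw w' hw'
    rwa [← angle_eq x w hx (hSP hw) hxw, ← angle_eq y w' hy (hTP hw') hyw, hy0, sub_zero] at this
  · have := cross w' hw' w hw
    rwa [← angle_eq x w hx (hTP hw) hxw, ← angle_eq y w' hy (hSP hw') hyw, hy0, zero_sub,
      abs_neg] at this
  · exact (same T hT hTP w hw w' hw' hxw hyw).elim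

variable (P) in
lemma exists_eq_add_natCast (i a : ZMod P.n) : ∃ m < P.n, a = i + (m : ZMod P.n) :=
  ⟨(a - i).val, ZMod.val_lt _, by simp⟩

variable (P) in
lemma sum_eq_sum_range (i : ZMod P.n) (f : ZMod P.n → ℝ) :
    ∑ a, f a = ∑ m ∈ Finset.range P.n, f (i + m) := by
  symm
  refine Finset.sum_nbij (fun m : ℕ => i + (m : ZMod P.n)) (fun _ _ => Finset.mem_univ _) ?_ ?_
    fun _ _ => rfl
  · intro a ha b hb h
    simp only [Finset.coe_range, mem_Iio] at ha hb
    exact P.natCast_injOn ha hb (add_left_cancel h)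
  · intro a _
    obtain ⟨m, hm, rfl⟩ := P.exists_eq_add_natCast i a
    exact ⟨m, by simpa using hm, rfl⟩

lemma val_add_one_of_lt {k : ℕ} {a : ZMod (k + 1)} (h : a.val < k) :
    (a + 1).val = a.val + 1 := by
  have h1 : a + 1 = ((a.val + 1 : ℕ) : ZMod (k + 1)) := by simp
  rw [h1, ZMod.val_natCast, Nat.mod_eq_of_lt (by omega)]

lemma add_one_eq_zero_of_val_eq {k : ℕ} {a : ZMod (k + 1)} (h : a.val = k) : a + 1 = 0 := by
  have h1 : a + 1 = ((a.val + 1 : ℕ) : ZMod (k + 1)) := by simp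
  rw [h1, h, ZMod.natCast_self]

section Chord

variable {i : ZMod P.n} {k : ℕ}

lemma add_natCast_ne {a b : ℕ} (ha : a < P.n) (hb : b < P.n) (h : a ≠ b) :
    i + (a : ZMod P.n) ≠ i + (b : ZMod P.n) :=
  fun e => h (P.natCast_injOn ha hb (add_left_cancel e))

lemma segment_inter_boundary (hk : openSegment ℝ (P.verts (i + k)) (P.verts i) ∩ P.boundary = ∅)
    {x : Pt} (hx : x ∈ segment ℝ (P.verts (i + k)) (P.verts i)) (hxP : x ∈ P.boundary) :
    x = P.verts (i + k) ∨ x = P.verts i := by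
  rw [← insert_endpoints_openSegment] at hx
  rcases hx with h | h | h
  · exact Or.inl h
  · exact Or.inr h
  · exact absurd (hk ▸ ⟨h, hxP⟩ : x ∈ (∅ : Set Pt)) (notMem_empty x)

lemma segment_chord_eq (a : ZMod (k + 1)) :
    (a.val < k ∧ segment ℝ (P.verts (i + a.val)) (P.verts (i + (a + 1).val)) =
      P.edge (i + a.val)) ∨
    (a.val = k ∧ segment ℝ (P.verts (i + a.val)) (P.verts (i + (a + 1).val)) =
      segment ℝ (P.verts (i + k)) (P.verts i)) := by
  have hlt := ZMod.val_lt a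
  rcases (Nat.lt_succ_iff.1 hlt).lt_or_eq with h | h
  · refine Or.inl ⟨h, ?_⟩
    rw [val_add_one_of_lt h, edge, Nat.cast_succ, add_assoc]
  · refine Or.inr ⟨h, ?_⟩
    rw [add_one_eq_zero_of_val_eq h, h, ZMod.val_zero, Nat.cast_zero, add_zero]

lemma chord_inter_edge_eq_empty (hk : openSegment ℝ (P.verts (i + k)) (P.verts i) ∩ P.boundary = ∅)
    (hkn : k + 1 < P.n) {m : ℕ} (hm0 : m ≠ 0) (hmk : m + 1 < k) :
    segment ℝ (P.verts (i + k)) (P.verts i) ∩ P.edge (i + m) = ∅ := by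
  by_contra hne
  obtain ⟨x, hx, hxm⟩ := nonempty_iff_ne_empty.2 hne
  have hn := P.three_le
  have hsucc : i + (m : ZMod P.n) + 1 = i + (m + 1 : ℕ) := by push_cast; ring
  rcases segment_inter_boundary hk hx (P.edge_subset_boundary _ hxm) with rfl | rfl
  · rcases P.verts_mem_edge hxm with h | h
    · exact add_natCast_ne (by omega) (by omega) (by omega) h
    · rw [hsucc] at h
      exact add_natCast_ne (by omega) (by omega) (by omega) h
  · rcases P.verts_mem_edge hxm with h | h
    · exact add_natCast_ne (a := 0) (b := m) (i := i) (by omega) (by omega) (by omega)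
        (by simpa using h)
    · rw [hsucc] at h
      exact add_natCast_ne (a := 0) (b := m + 1) (i := i) (by omega) (by omega) (by omega)
        (by simpa using h)

variable (P i k) in
/-- The polygon cut off from `P` by the chord joining vertex `i + k` to vertex `i`. -/
noncomputable def cutOff (h2 : 2 ≤ k) (hkn : k + 1 < P.n)
    (hk : openSegment ℝ (P.verts (i + k)) (P.verts i) ∩ P.boundary = ∅) : SimplePolygon where
  n := k + 1
  three_le := by omega
  verts a := P.verts (i + a.val)
  inj := by
    intro a b h
    have ha := ZMod.val_lt a
    have hb := ZMod.val_lt b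
    exact ZMod.val_injective _
      (P.natCast_injOn (by omega) (by omega) (add_left_cancel (P.inj h)))
  edges_nonadj := by
    intro a b hba hba' hab'
    have hn := P.three_le
    have hne : a.val ≠ b.val := fun h => hba (ZMod.val_injective _ h).symm
    rcases segment_chord_eq (P := P) (i := i) a with ⟨ha, ea⟩ | ⟨ha, ea⟩ <;>
      rcases segment_chord_eq (P := P) (i := i) b with ⟨hb, eb⟩ | ⟨hb, eb⟩ <;> rw [ea, eb]
    · have h1 : b.val ≠ a.val + 1 := fun h =>
        hba' (ZMod.val_injective _ (by rw [val_add_one_of_lt ha, h]))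
      have h2 : a.val ≠ b.val + 1 := fun h =>
        hab' (ZMod.val_injective _ (by rw [val_add_one_of_lt hb, h]))
      apply P.edges_nonadj
      · exact add_natCast_ne (by omega) (by omega) hne.symm
      · rw [add_assoc, ← Nat.cast_succ]
        exact add_natCast_ne (by omega) (by omega) h1
      · rw [add_assoc, ← Nat.cast_succ]
        exact add_natCast_ne (by omega) (by omega) h2
    · rw [inter_comm]
      apply chord_inter_edge_eq_empty hk hkn
      · intro h
        rw [add_one_eq_zero_of_val_eq hb] at hab'
        exact hab' ((ZMod.val_eq_zero _).1 h)
      · by_contra h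
        exact hba' (ZMod.val_injective _ (by rw [val_add_one_of_lt ha]; omega))
    · apply chord_inter_edge_eq_empty hk hkn
      · intro h
        rw [add_one_eq_zero_of_val_eq ha] at hba'
        exact hba' ((ZMod.val_eq_zero _).1 h)
      · by_contra h
        exact hab' (ZMod.val_injective _ (by rw [val_add_one_of_lt hb]; omega))
    · omega
  edges_adj := by
    intro a
    have hn := P.three_le
    apply Subset.antisymm
    · rintro x ⟨hx1, hx2⟩
      rw [mem_singleton_iff]
      rcases segment_chord_eq (P := P) (i := i) a with ⟨ha, ea⟩ | ⟨ha, ea⟩ <;>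
        rcases segment_chord_eq (P := P) (i := i) (a + 1) with ⟨hb, eb⟩ | ⟨hb, eb⟩ <;>
        rw [ea] at hx1 <;> rw [eb] at hx2
      · rw [val_add_one_of_lt ha, Nat.cast_succ, ← add_assoc] at hx2 ⊢
        exact (P.edges_adj _ ▸ ⟨hx1, hx2⟩ : x ∈ ({P.verts (i + a.val + 1)} : Set Pt))
      · rw [hb]
        rcases segment_inter_boundary hk hx2 (P.edge_subset_boundary _ hx1) with h | rfl
        · exact h
        · rw [val_add_one_of_lt ha] at hb
          exfalso
          rcases P.verts_mem_edge hx1 with h | h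
          · exact add_natCast_ne (a := 0) (b := a.val) (i := i) (by omega) (by omega)
              (by omega) (by simpa using h)
          · exact add_natCast_ne (a := 0) (b := a.val + 1) (i := i) (by omega) (by omega)
              (by omega) (by simpa [add_assoc] using h)
      · rw [add_one_eq_zero_of_val_eq ha, ZMod.val_zero, Nat.cast_zero, add_zero] at hx2 ⊢
        rcases segment_inter_boundary hk hx1 (P.edge_subset_boundary _ hx2) with rfl | h
        · exfalso
          rcases P.verts_mem_edge hx2 with h | h
          · exact add_natCast_ne (a := k) (b := 0) (i := i) (by omega) (by omega)
              (by omega) (by simpa using h)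
          · exact add_natCast_ne (a := k) (b := 1) (i := i) (by omega) (by omega)
              (by omega) (by simpa using h)
        · exact h
      · rw [add_one_eq_zero_of_val_eq ha, ZMod.val_zero] at hb
        omega
    · exact singleton_subset_iff.2 ⟨right_mem_segment ℝ _ _, left_mem_segment ℝ _ _⟩

variable (h2 : 2 ≤ k) (hkn : k + 1 < P.n)
  (hk : openSegment ℝ (P.verts (i + k)) (P.verts i) ∩ P.boundary = ∅)

lemma val_natCast_of_le {m : ℕ} (hm : m ≤ k) : (m : ZMod (k + 1)).val = m :=
  ZMod.val_cast_of_lt (by omega)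

lemma range_verts_cutOff :
    range (P.cutOff i k h2 hkn hk).verts = {x | ∃ m ≤ k, x = P.verts (i + (m : ℕ))} := by
  ext x
  constructor
  · rintro ⟨a, rfl⟩
    exact ⟨ZMod.val (n := k + 1) a, Nat.lt_succ_iff.1 (ZMod.val_lt (n := k + 1) a), rfl⟩
  · rintro ⟨m, hm, rfl⟩
    refine ⟨(m : ZMod (k + 1)), ?_⟩
    change P.verts (i + (m : ZMod (k + 1)).val) = _
    rw [val_natCast_of_le hm]

lemma boundary_cutOff :
    (P.cutOff i k h2 hkn hk).boundary = {x | ∃ m < k, x ∈ P.edge (i + (m : ℕ))} ∪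
      segment ℝ (P.verts (i + k)) (P.verts i) := by
  ext x
  constructor
  · intro hx
    obtain ⟨a, ha⟩ := mem_iUnion.1 hx
    rcases segment_chord_eq (P := P) (i := i) (k := k) a with ⟨h, e⟩ | ⟨h, e⟩
    · exact Or.inl ⟨_, h, e ▸ ha⟩
    · exact Or.inr (e ▸ ha)
  · rintro (⟨m, hm, hx⟩ | hx)
    · refine mem_iUnion.2 ⟨(m : ZMod (k + 1)), ?_⟩
      rcases segment_chord_eq (P := P) (i := i) (k := k) (m : ZMod (k + 1)) with ⟨h, e⟩ | ⟨h, e⟩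
      · have hx' : x ∈ P.edge (i + (m : ZMod (k + 1)).val) := by rwa [val_natCast_of_le hm.le]
        exact e.symm ▸ hx'
      · rw [val_natCast_of_le hm.le] at h
        omega
    · refine mem_iUnion.2 ⟨(k : ZMod (k + 1)), ?_⟩
      rcases segment_chord_eq (P := P) (i := i) (k := k) (k : ZMod (k + 1)) with ⟨h, e⟩ | ⟨h, e⟩
      · rw [val_natCast_of_le le_rfl] at h
        omega
      · exact e.symm ▸ hx

lemma totalAngle_cutOff (x : Pt) :
    (P.cutOff i k h2 hkn hk).totalAngle x =
      ∑ m ∈ Finset.range k, viewAngle (P.verts (i + (m : ℕ))) (P.verts (i + (m : ℕ) + 1)) x +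
      viewAngle (P.verts (i + k)) (P.verts i) x := by
  rw [totalAngle, (P.cutOff i k h2 hkn hk).sum_eq_sum_range 0]
  change ∑ m ∈ Finset.range (k + 1), viewAngle (P.verts (i + (0 + (m : ZMod (k + 1))).val))
    (P.verts (i + (0 + (m : ZMod (k + 1)) + 1).val)) x = _
  rw [Finset.sum_range_succ]
  congr 1
  · refine Finset.sum_congr rfl fun m hm => ?_
    have hm' := Finset.mem_range.1 hm
    have hv := val_natCast_of_le hm'.le
    rw [zero_add, val_add_one_of_lt (by rw [hv]; exact hm'), hv, Nat.cast_succ, add_assoc]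
  · have hv := val_natCast_of_le (le_refl k)
    rw [zero_add, add_one_eq_zero_of_val_eq hv, hv, ZMod.val_zero, Nat.cast_zero, add_zero]

lemma isEdgeOf_cutOff : (P.cutOff i k h2 hkn hk).IsEdgeOf (P.verts i) (P.verts (i + k)) := by
  have hv := val_natCast_of_le (le_refl k)
  refine ⟨(k : ZMod (k + 1)), Or.inr ⟨?_, ?_⟩⟩
  · change _ = P.verts (i + (k : ZMod (k + 1)).val)
    rw [hv]
  · change _ = P.verts (i + ((k : ZMod (k + 1)) + 1).val)
    rw [add_one_eq_zero_of_val_eq hv, ZMod.val_zero, Nat.cast_zero, add_zero]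

end Chord

lemma mem_interiorRegion_of_boundary_subset {Q : SimplePolygon}
    (hQ : Q.boundary ⊆ P.boundary ∪ P.interiorRegion) {x : Pt} (hxP : x ∉ P.boundary)
    (hx : x ∈ Q.interiorRegion) : x ∈ P.interiorRegion := by
  by_contra hcon
  have hU : ¬ Bornology.IsBounded (connectedComponentIn P.boundaryᶜ x) := fun h =>
    hcon ⟨hxP, h⟩
  apply hU
  refine hx.2.subset ?_
  refine isPreconnected_connectedComponentIn.subset_connectedComponentIn
    (mem_connectedComponentIn hxP) fun y hy hyQ => ?_
  rcases hQ hyQ with h | h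
  · exact connectedComponentIn_subset _ _ hy h
  · exact hU (connectedComponentIn_eq hy ▸ h.2)

lemma abs_totalAngle_of_mem_interiorRegion {x : Pt} (hx : x ∈ P.interiorRegion) :
    |P.totalAngle x| = 2 * Real.pi :=
  abs_totalAngle_of_isBounded hx.1 hx.2

lemma totalAngle_eq_zero_of_notMem {x : Pt} (hx : x ∉ P.boundary) (hxi : x ∉ P.interiorRegion) :
    P.totalAngle x = 0 :=
  totalAngle_eq_zero_of_not_isBounded hx fun h => hxi ⟨hx, h⟩

/-- If three polygons form a theta curve whose middle arc runs inside the first polygon, then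
that polygon's closed region is split into those of the other two. -/
lemma interiorRegion_split {Q R : SimplePolygon} (hPQR : P.boundary ⊆ Q.boundary ∪ R.boundary)
    (hQ : Q.boundary ⊆ P.boundary ∪ P.interiorRegion)
    (hR : R.boundary ⊆ P.boundary ∪ P.interiorRegion)
    (hangle : ∀ x, x ∉ Q.boundary → x ∉ R.boundary →
      P.totalAngle x = Q.totalAngle x + R.totalAngle x) :
    Disjoint Q.interiorRegion R.interiorRegion ∧
      (Q.interiorRegion ∪ Q.boundary) ∪ (R.interiorRegion ∪ R.boundary) =
        P.interiorRegion ∪ P.boundary := by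
  constructor
  · rw [Set.disjoint_left]
    intro x hxQ hxR
    have hxP : x ∉ P.boundary := fun h => (hPQR h).elim hxQ.1 hxR.1
    have aP := abs_totalAngle_of_mem_interiorRegion (mem_interiorRegion_of_boundary_subset hQ hxP hxQ)
    have aQ := abs_totalAngle_of_mem_interiorRegion hxQ
    have aR := abs_totalAngle_of_mem_interiorRegion hxR
    rw [hangle x hxQ.1 hxR.1] at aP
    have := Real.pi_pos
    rcases eq_or_eq_neg_of_abs_eq aP with h | h <;> rcases eq_or_eq_neg_of_abs_eq aQ with h' | h' <;>
      rcases eq_or_eq_neg_of_abs_eq aR with h'' | h'' <;> linarith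
  · apply Subset.antisymm
    · have key : ∀ S : SimplePolygon, S.boundary ⊆ P.boundary ∪ P.interiorRegion →
          S.interiorRegion ∪ S.boundary ⊆ P.interiorRegion ∪ P.boundary := by
        rintro S hS x (hx | hx)
        · by_cases hxP : x ∈ P.boundary
          · exact Or.inr hxP
          · exact Or.inl (mem_interiorRegion_of_boundary_subset hS hxP hx)
        · exact (hS hx).symm
      exact union_subset (key Q hQ) (key R hR)
    · rintro x (hx | hx)
      · by_contra hcon
        simp only [mem_union, not_or] at hcon
        obtain ⟨⟨h1, h2⟩, h3, h4⟩ := hcon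
        have aP := abs_totalAngle_of_mem_interiorRegion hx
        rw [hangle x h2 h4, totalAngle_eq_zero_of_notMem h2 h1, totalAngle_eq_zero_of_notMem h4 h3,
          add_zero, abs_zero] at aP
        linarith [Real.pi_pos]
      · exact (hPQR hx).imp Or.inr Or.inr

end SimplePolygon

/-- An internal diagonal `uv` of a simple polygon `P` splits `P` into two simple
polygons `P₁, P₂`, each having `uv` as an edge, with disjoint interiors, whose closed
regions together give the closed region bounded by `P`, and every vertex of `P` other
than `u, v` is a vertex of exactly one of `P₁, P₂`. -/
theorem internal_diagonal_splits_polygon (P : SimplePolygon) (u v : Pt)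
    (hD : P.IsInternalDiagonal u v) :
    ∃ P₁ P₂ : SimplePolygon,
      P₁.IsEdgeOf u v ∧ P₂.IsEdgeOf u v ∧
      Disjoint P₁.interiorRegion P₂.interiorRegion ∧
      (P₁.interiorRegion ∪ P₁.boundary) ∪ (P₂.interiorRegion ∪ P₂.boundary)
        = P.interiorRegion ∪ P.boundary ∧
      Set.range P₁.verts ∪ Set.range P₂.verts = Set.range P.verts ∧
      Set.range P₁.verts ∩ Set.range P₂.verts = {u, v} := by
  obtain ⟨⟨i, rfl⟩, ⟨j, rfl⟩, hne, hedge, hvals⟩ := hD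
  obtain ⟨k, hkn, rfl⟩ := P.exists_eq_add_natCast i j
  have hn := P.three_le
  have hk0 : k ≠ 0 := by
    rintro rfl
    simp at hne
  have hk1 : k ≠ 1 := by
    rintro rfl
    exact hedge ⟨i, Or.inl ⟨rfl, by simp⟩⟩
  have hcast : ((P.n - k : ℕ) : ZMod P.n) = -(k : ZMod P.n) := by
    rw [Nat.cast_sub hkn.le, ZMod.natCast_self, zero_sub]
  have hback : i + (k : ZMod P.n) + ((P.n - k : ℕ) : ZMod P.n) = i := by
    rw [hcast, add_neg_cancel_right]
  have hkn1 : k + 1 ≠ P.n := by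
    intro h
    refine hedge ⟨i + k, Or.inr ⟨rfl, ?_⟩⟩
    rw [add_assoc, ← Nat.cast_succ, Nat.succ_eq_add_one, h, ZMod.natCast_self, add_zero]
  have hd1 : openSegment ℝ (P.verts (i + k)) (P.verts i) ∩ P.boundary = ∅ := by
    rw [openSegment_symm]
    exact eq_empty_of_forall_notMem fun x hx => (hvals hx.1).1 hx.2
  have hd2 : openSegment ℝ (P.verts (i + k + (P.n - k : ℕ))) (P.verts (i + k)) ∩ P.boundary =
      ∅ := by
    rw [hback]
    exact eq_empty_of_forall_notMem fun x hx => (hvals hx.1).1 hx.2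
  set Q := P.cutOff i k (by omega) (by omega) hd1 with hQdef
  set R := P.cutOff (i + k) (P.n - k) (by omega) (by omega) hd2 with hRdef
  have hQb : Q.boundary = _ := SimplePolygon.boundary_cutOff _ _ hd1
  have hRb : R.boundary = _ := SimplePolygon.boundary_cutOff _ _ hd2
  have hQv : range Q.verts = _ := SimplePolygon.range_verts_cutOff _ _ hd1
  have hRv : range R.verts = _ := SimplePolygon.range_verts_cutOff _ _ hd2
  have hD : segment ℝ (P.verts i) (P.verts (i + k)) ⊆ P.boundary ∪ P.interiorRegion := by
    rw [← insert_endpoints_openSegment]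
    rintro x (rfl | rfl | hx)
    · exact Or.inl (P.verts_mem_boundary _)
    · exact Or.inl (P.verts_mem_boundary _)
    · exact Or.inr (hvals hx)
  have hshift : ∀ m : ℕ, k ≤ m → i + (m : ZMod P.n) = i + k + ((m - k : ℕ) : ZMod P.n) := by
    intro m hm
    rw [Nat.cast_sub hm]
    ring
  obtain ⟨hdisj, hunion⟩ := SimplePolygon.interiorRegion_split (P := P) (Q := Q) (R := R)
    (by
      intro x hx
      obtain ⟨a, ha⟩ := mem_iUnion.1 hx
      obtain ⟨m, hm, rfl⟩ := P.exists_eq_add_natCast i a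
      rw [hQb, hRb]
      rcases lt_or_ge m k with h | h
      · exact Or.inl (Or.inl ⟨m, h, ha⟩)
      · refine Or.inr (Or.inl ⟨m - k, by omega, ?_⟩)
        rw [← hshift m h]
        exact ha)
    (by
      rw [hQb, segment_symm]
      refine union_subset ?_ hD
      rintro x ⟨m, -, hx⟩
      exact Or.inl (P.edge_subset_boundary _ hx))
    (by
      rw [hRb, hback]
      refine union_subset ?_ hD
      rintro x ⟨m, -, hx⟩
      exact Or.inl (P.edge_subset_boundary _ hx))
    (by
      intro x hxQ _
      have hx : x ∉ segment ℝ (P.verts (i + k)) (P.verts i) := fun h =>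
        hxQ (hQb ▸ Or.inr h)
      rw [hQdef, hRdef, SimplePolygon.totalAngle_cutOff, SimplePolygon.totalAngle_cutOff, hback,
        viewAngle_swap hx, SimplePolygon.totalAngle, P.sum_eq_sum_range i]
      obtain ⟨l, hl⟩ : ∃ l, P.n = k + l := ⟨P.n - k, by omega⟩
      have hl' : P.n - k = l := by omega
      rw [hl', show Finset.range P.n = Finset.range (k + l) by rw [hl], Finset.sum_range_add]
      simp only [Nat.cast_add, add_assoc]
      ring)
  refine ⟨Q, R, SimplePolygon.isEdgeOf_cutOff _ _ hd1, ?_, hdisj, hunion, ?_, ?_⟩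
  · have h := SimplePolygon.isEdgeOf_cutOff (P := P) (by omega) (by omega) hd2
    rw [hback] at h
    obtain ⟨a, ha⟩ := h
    exact ⟨a, ha.symm⟩
  · rw [hQv, hRv]
    apply Subset.antisymm
    · rintro x (⟨m, -, rfl⟩ | ⟨m, -, rfl⟩) <;> exact mem_range_self _
    · rintro _ ⟨a, rfl⟩
      obtain ⟨m, hm, rfl⟩ := P.exists_eq_add_natCast i a
      rcases le_total m k with h | h
      · exact Or.inl ⟨m, h, rfl⟩
      · exact Or.inr ⟨m - k, by omega, by rw [← hshift m h]⟩
  · rw [hQv, hRv]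
    apply Subset.antisymm
    · rintro x ⟨⟨m, hm, rfl⟩, l, hl, h⟩
      rcases Nat.eq_zero_or_pos m with rfl | hm0
      · exact Or.inl (by simp)
      right
      have h' := add_left_cancel ((P.inj h).trans (add_assoc i (k : ZMod P.n) l))
      rw [← Nat.cast_add] at h'
      rcases (show k + l ≤ P.n by omega).lt_or_eq with hlt | heq
      · have := P.natCast_injOn (by omega) hlt h'
        rw [show m = k by omega]
        rfl
      · rw [heq, ZMod.natCast_self, ← Nat.cast_zero] at h'
        exact absurd (P.natCast_injOn (by omega) (by omega) h') hm0.ne'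
    · rintro x (rfl | rfl)
      · exact ⟨⟨0, by omega, by simp⟩, P.n - k, le_rfl, by rw [hback]⟩
      · exact ⟨⟨k, le_rfl, rfl⟩, 0, by omega, by simp⟩
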